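/- arXiv:2004.00054 — 2 statements merged into one kernel-verified Lean document; each statement's English description precedes it below -/
import Mathlib

section
/- Let f : ℝ × ℝ → ℝ be a smooth function that is 2π-periodic in each variable and satisfies ∂²f/∂θ² + ∂²f/∂φ² + 2f = 0 everywhere. Then there exists a 2×2 real matrix A such that f = ψ_A. Conversely, for every 2×2 real matrix A, the function ψ_A is 2π-periodic in each variable and satisfies ∂²ψ_A/∂θ² + ∂²ψ_A/∂φ² + 2ψ_A = 0. (Thus the kernel of Δ+2 on the flat torus consists precisely of the functions ψ_A.) -/
open Real

/-- The function `ψ_A` on the torus associated with a `2 × 2` matrix `A`. -/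
noncomputable def psiFun (A : Matrix (Fin 2) (Fin 2) ℝ) (θ φ : ℝ) : ℝ :=
  A 0 0 * Real.cos θ * Real.cos φ + A 0 1 * Real.cos θ * Real.sin φ +
    A 1 0 * Real.sin θ * Real.cos φ + A 1 1 * Real.sin θ * Real.sin φ


lemma aux_contDiff1 {F : ℝ × ℝ → ℝ} (hF : ContDiff ℝ (⊤ : ℕ∞) F) :
    ContDiff ℝ (⊤ : ℕ∞) (fun p : ℝ × ℝ => deriv (fun t => F (t, p.2)) p.1) := by
  have h : (fun p : ℝ × ℝ => deriv (fun t => F (t, p.2)) p.1)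
      = fun p => fderiv ℝ F p (1, 0) := by
    funext p
    have h1 : HasFDerivAt F (fderiv ℝ F p) (p.1, p.2) :=
      (hF.differentiable (by simp) p).hasFDerivAt
    have h2 : HasDerivAt (fun t : ℝ => (t, p.2)) ((1 : ℝ), (0 : ℝ)) p.1 :=
      (hasDerivAt_id p.1).prodMk (hasDerivAt_const p.1 p.2)
    exact (h1.comp_hasDerivAt p.1 h2).deriv
  rw [h]
  exact (hF.fderiv_right (m := (⊤ : ℕ∞)) (by simp)).clm_apply contDiff_const

lemma aux_contDiff2 {F : ℝ × ℝ → ℝ} (hF : ContDiff ℝ (⊤ : ℕ∞) F) :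
    ContDiff ℝ (⊤ : ℕ∞) (fun p : ℝ × ℝ => deriv (fun t => F (p.1, t)) p.2) := by
  have hs : ContDiff ℝ (⊤ : ℕ∞) (fun p : ℝ × ℝ => (p.2, p.1)) := contDiff_snd.prodMk contDiff_fst
  exact (aux_contDiff1 (hF.comp hs)).comp hs

lemma aux_ode {h : ℝ → ℝ} (hd : ContDiff ℝ 2 h) (he : ∀ x, deriv (deriv h) x + h x = 0) (x : ℝ) :
    h x = h 0 * cos x + h (π / 2) * sin x := by
  have d1 : ∀ x, HasDerivAt h (deriv h x) x := fun x =>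
    (hd.differentiable (by simp) x).hasDerivAt
  have hd' : ContDiff ℝ 1 (deriv h) := by
    have : ContDiff ℝ (1 + 1) h := by simpa [one_add_one_eq_two] using hd
    exact (contDiff_succ_iff_deriv.1 this).2.2
  have d2 : ∀ x, HasDerivAt (deriv h) (deriv (deriv h) x) x := fun x =>
    (hd'.differentiable (by simp) x).hasDerivAt
  have c1 : ∀ x, HasDerivAt (fun x => h x * cos x - deriv h x * sin x) 0 x := fun x => by
    refine (((d1 x).mul (hasDerivAt_cos x)).sub ((d2 x).mul (hasDerivAt_sin x))).congr_deriv ?_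
    linear_combination (- sin x) * he x
  have c2 : ∀ x, HasDerivAt (fun x => h x * sin x + deriv h x * cos x) 0 x := fun x => by
    refine (((d1 x).mul (hasDerivAt_sin x)).add ((d2 x).mul (hasDerivAt_cos x))).congr_deriv ?_
    linear_combination (cos x) * he x
  have e1 := fun x y => is_const_of_deriv_eq_zero (fun x => (c1 x).differentiableAt)
    (fun x => (c1 x).deriv) x y
  have e2 := fun x y => is_const_of_deriv_eq_zero (fun x => (c2 x).differentiableAt)
    (fun x => (c2 x).deriv) x y
  have a1 := e1 x 0
  have a2 := e2 x (π / 2)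
  simp at a1 a2
  linear_combination cos x * a1 + sin x * a2 - h x * sin_sq_add_cos_sq x

lemma aux_per {h : ℝ → ℝ} (hd : ContDiff ℝ 2 h) (hp : ∀ x, h (x + 2 * π) = h x) (n : ℤ) :
    ∫ x in (0 : ℝ)..(2 * π), ((deriv (deriv h) x + n ^ 2 * h x : ℝ) : ℂ)
      * Complex.exp (-(n * x * Complex.I)) = 0 := by
  have d1 : ∀ x, HasDerivAt h (deriv h x) x := fun x =>
    (hd.differentiable (by simp) x).hasDerivAt
  have hd' : ContDiff ℝ 1 (deriv h) := by
    have : ContDiff ℝ (1 + 1) h := by simpa [one_add_one_eq_two] using hd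
    exact (contDiff_succ_iff_deriv.1 this).2.2
  have d2 : ∀ x, HasDerivAt (deriv h) (deriv (deriv h) x) x := fun x =>
    (hd'.differentiable (by simp) x).hasDerivAt
  have hc : Continuous (deriv (deriv h)) := hd'.continuous_deriv (by simp)
  have hc0 : Continuous h := hd.continuous
  have hp' : ∀ x, deriv h (x + 2 * π) = deriv h x := fun x => by
    rw [← deriv_comp_add_const]
    congr 1
    funext y
    exact hp y
  have ex : ∀ x : ℝ, HasDerivAt (fun x : ℝ => Complex.exp (-(n * x * Complex.I)))
      (Complex.exp (-(n * x * Complex.I)) * (-(n * 1 * Complex.I))) x := fun x =>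
    ((((hasDerivAt_id x).ofReal_comp.const_mul (n : ℂ)).mul_const Complex.I).neg).cexp
  have key : ∀ x : ℝ, HasDerivAt (fun x : ℝ => (((deriv h x : ℝ) : ℂ) + n * Complex.I * (h x : ℂ))
      * Complex.exp (-(n * x * Complex.I)))
      (((deriv (deriv h) x + n ^ 2 * h x : ℝ) : ℂ) * Complex.exp (-(n * x * Complex.I))) x := by
    intro x
    refine (((d2 x).ofReal_comp.add ((d1 x).ofReal_comp.const_mul (n * Complex.I))).mul
      (ex x)).congr_deriv ?_
    push_cast
    simp only [Pi.add_apply]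
    linear_combination (- (n : ℂ)^2 * h x * Complex.exp (-(n * x * Complex.I))) * Complex.I_sq
  rw [intervalIntegral.integral_eq_sub_of_hasDerivAt (fun x _ => key x)
    (Continuous.intervalIntegrable (by fun_prop) _ _)]
  have h1 := hp 0
  have h2 := hp' 0
  rw [zero_add] at h1 h2
  rw [h1, h2]
  have : Complex.exp (-(n * ((2 * π : ℝ) : ℂ) * Complex.I)) = 1 := by
    rw [Complex.exp_eq_one_iff]
    exact ⟨-n, by push_cast; ring⟩
  rw [this]
  simp

lemma aux_uniq {h : ℝ → ℂ} (hc : Continuous h) (hp : ∀ x, h (x + 2 * π) = h x)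
    (h0 : ∀ n : ℤ, ∫ x in (0 : ℝ)..(2 * π), h x * Complex.exp (-(n * x * Complex.I)) = 0) (x : ℝ) :
    h x = 0 := by
  have : Fact (0 < 2 * π) := ⟨Real.two_pi_pos⟩
  have hper : Function.Periodic h (2 * π) := hp
  let g : C(AddCircle (2 * π), ℂ) := ⟨hper.lift, continuous_coinduced_dom.mpr hc⟩
  have hg : ∀ n, fourierCoeff g n = 0 := by
    intro n
    rw [fourierCoeff_eq_intervalIntegral _ n 0, zero_add]
    rw [← smul_zero (M := ℝ) (A := ℂ) (1 / (2 * π)), ← h0 n]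
    congr 1
    refine intervalIntegral.integral_congr fun y _ => ?_
    have : g (y : AddCircle (2 * π)) = h y := rfl
    simp only [this, fourier_coe_apply, smul_eq_mul]
    rw [mul_comm]
    congr 2
    push_cast
    field_simp
  have hs := has_pointwise_sum_fourier_series_of_summable (f := g)
    (by rw [show fourierCoeff g = 0 from funext hg]; exact summable_zero) (x : AddCircle (2 * π))
  simp only [hg, zero_smul] at hs
  exact hs.unique hasSum_zero

lemma aux_swap {g : ℝ → ℝ → ℂ} (hg : Continuous (fun p : ℝ × ℝ => g p.1 p.2)) :
    ∫ x in (0 : ℝ)..(2 * π), ∫ y in (0 : ℝ)..(2 * π), g x y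
      = ∫ y in (0 : ℝ)..(2 * π), ∫ x in (0 : ℝ)..(2 * π), g x y := by
  have hpi := Real.two_pi_pos.le
  simp only [intervalIntegral.integral_of_le hpi]
  refine MeasureTheory.integral_integral_swap ?_
  rw [MeasureTheory.Measure.prod_restrict]
  refine MeasureTheory.IntegrableOn.mono_set (t := Set.Icc 0 (2 * π) ×ˢ Set.Icc 0 (2 * π)) ?_
    (Set.prod_mono Set.Ioc_subset_Icc_self Set.Ioc_subset_Icc_self)
  exact hg.continuousOn.integrableOn_compact (isCompact_Icc.prod isCompact_Icc)

lemma aux_main {f : ℝ → ℝ → ℝ} (hf : ContDiff ℝ (⊤ : ℕ∞) (fun p : ℝ × ℝ => f p.1 p.2))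
    (p1 : ∀ θ φ, f (θ + 2 * π) φ = f θ φ) (p2 : ∀ θ φ, f θ (φ + 2 * π) = f θ φ)
    (he : ∀ θ φ, deriv (deriv (fun θ' => f θ' φ)) θ
        + deriv (deriv (fun φ' => f θ φ')) φ + 2 * f θ φ = 0) (θ φ : ℝ) :
    deriv (deriv (fun φ' => f θ φ')) φ + f θ φ = 0 := by
  have s1 : ∀ φ, ContDiff ℝ 2 (fun θ => f θ φ) := fun φ =>
    contDiff_infty.1 (hf.comp (contDiff_id.prodMk contDiff_const)) 2
  have s2 : ∀ θ, ContDiff ℝ 2 (fun φ => f θ φ) := fun θ =>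
    contDiff_infty.1 (hf.comp (contDiff_const.prodMk contDiff_id)) 2
  have k0 : Continuous (fun p : ℝ × ℝ => f p.1 p.2) := hf.continuous
  have k2 : Continuous (fun p : ℝ × ℝ => deriv (deriv (fun φ' => f p.1 φ')) p.2) :=
    (aux_contDiff2 (aux_contDiff2 hf)).continuous
  -- one dimensional coefficients
  have q2 : ∀ (n : ℤ) (θ : ℝ), ∫ y in (0 : ℝ)..(2 * π),
      ((deriv (deriv (fun φ' => f θ φ')) y + f θ y : ℝ) : ℂ) * Complex.exp (-(n * y * Complex.I))
      = (1 - n ^ 2) * ∫ y in (0 : ℝ)..(2 * π), (f θ y : ℂ) * Complex.exp (-(n * y * Complex.I)) := by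
    intro n θ
    have h := aux_per (s2 θ) (p2 θ) n
    have k2' : Continuous (fun y => deriv (deriv (fun φ' => f θ φ')) y) :=
      k2.comp (Continuous.prodMk_right θ)
    have k0' : Continuous (fun y => f θ y) := (s2 θ).continuous
    rw [← intervalIntegral.integral_const_mul, ← sub_eq_zero, ← h,
      ← intervalIntegral.integral_sub (Continuous.intervalIntegrable (by fun_prop) _ _)
        (Continuous.intervalIntegrable (by fun_prop) _ _)]
    refine intervalIntegral.integral_congr fun y _ => ?_
    push_cast
    ring
  have q1 : ∀ (m : ℤ) (φ : ℝ), ∫ x in (0 : ℝ)..(2 * π),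
      ((deriv (deriv (fun φ' => f x φ')) φ + f x φ : ℝ) : ℂ) * Complex.exp (-(m * x * Complex.I))
      = (m ^ 2 - 1) * ∫ x in (0 : ℝ)..(2 * π), (f x φ : ℂ) * Complex.exp (-(m * x * Complex.I)) := by
    intro m φ
    have h := aux_per (s1 φ) (fun θ => p1 θ φ) m
    have k2' : Continuous (fun x => deriv (deriv (fun φ' => f x φ')) φ) :=
      k2.comp (Continuous.prodMk_left φ)
    have k0' : Continuous (fun x => f x φ) := (s1 φ).continuous
    rw [← intervalIntegral.integral_const_mul, ← sub_eq_zero, ← neg_eq_zero, ← h,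
      ← intervalIntegral.integral_sub (Continuous.intervalIntegrable (by fun_prop) _ _)
        (Continuous.intervalIntegrable (by fun_prop) _ _), ← intervalIntegral.integral_neg]
    refine intervalIntegral.integral_congr fun x _ => ?_
    have := he x φ
    have e : deriv (deriv (fun θ' => f θ' φ)) x
      = - deriv (deriv (fun φ' => f x φ')) φ - 2 * f x φ := by linarith
    simp only [e]
    push_cast
    ring
  have hn : ∀ (n : ℤ), n ^ 2 ≠ 1 → ∀ θ : ℝ,
      ∫ y in (0 : ℝ)..(2 * π), (f θ y : ℂ) * Complex.exp (-(n * y * Complex.I)) = 0 := by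
    intro n hn θ
    refine aux_uniq (h := fun θ => ∫ y in (0 : ℝ)..(2 * π), (f θ y : ℂ)
      * Complex.exp (-(n * y * Complex.I))) ?_ ?_ ?_ θ
    · refine intervalIntegral.continuous_parametric_intervalIntegral_of_continuous' ?_ _ _
      simp only [Function.uncurry_def]
      fun_prop
    · intro x
      simp only [p1]
    · intro m
      set D := ∫ x in (0 : ℝ)..(2 * π), (∫ y in (0 : ℝ)..(2 * π), (f x y : ℂ)
        * Complex.exp (-(n * y * Complex.I))) * Complex.exp (-(m * x * Complex.I)) with hD
      have hD' : D = ∫ y in (0 : ℝ)..(2 * π), (∫ x in (0 : ℝ)..(2 * π), (f x y : ℂ)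
        * Complex.exp (-(m * x * Complex.I))) * Complex.exp (-(n * y * Complex.I)) := by
        rw [hD]
        simp only [← intervalIntegral.integral_mul_const]
        rw [aux_swap (by fun_prop)]
        simp only [mul_right_comm]
      have e1 : ∫ x in (0 : ℝ)..(2 * π), (∫ y in (0 : ℝ)..(2 * π),
          ((deriv (deriv (fun φ' => f x φ')) y + f x y : ℝ) : ℂ)
          * Complex.exp (-(n * y * Complex.I))) * Complex.exp (-(m * x * Complex.I))
          = (1 - n ^ 2) * D := by
        simp only [q2]
        simp only [mul_assoc (_ - _ : ℂ)]
        rw [intervalIntegral.integral_const_mul]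
      have e2 : ∫ y in (0 : ℝ)..(2 * π), (∫ x in (0 : ℝ)..(2 * π),
          ((deriv (deriv (fun φ' => f x φ')) y + f x y : ℝ) : ℂ)
          * Complex.exp (-(m * x * Complex.I))) * Complex.exp (-(n * y * Complex.I))
          = (m ^ 2 - 1) * D := by
        simp only [q1]
        simp only [mul_assoc (_ - _ : ℂ)]
        rw [intervalIntegral.integral_const_mul, hD']
      have e3 : ((1 : ℂ) - n ^ 2) * D = (m ^ 2 - 1) * D := by
        rw [← e1, ← e2]
        simp only [← intervalIntegral.integral_mul_const]
        rw [aux_swap (by fun_prop)]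
        simp only [mul_right_comm]
      have e4 : (((m ^ 2 + n ^ 2 - 2 : ℤ)) : ℂ) * D = 0 := by
        push_cast
        linear_combination - e3
      rcases mul_eq_zero.1 e4 with h | h
      · exfalso
        have h' : m ^ 2 + n ^ 2 - 2 = 0 := by exact_mod_cast h
        have n1 : n ≤ 1 := by nlinarith [sq_nonneg m]
        have n2 : -1 ≤ n := by nlinarith [sq_nonneg m]
        have m1 : m ≤ 1 := by nlinarith [sq_nonneg n]
        have m2 : -1 ≤ m := by nlinarith [sq_nonneg n]
        clear_value D
        clear hD hD' e1 e2 e3 e4 h q1 q2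
        interval_cases n <;> interval_cases m <;> omega
      · exact h
  have hz := aux_uniq (h := fun y => ((deriv (deriv (fun φ' => f θ φ')) y + f θ y : ℝ) : ℂ))
    (by
      have k2' : Continuous (fun y => deriv (deriv (fun φ' => f θ φ')) y) :=
        k2.comp (Continuous.prodMk_right θ)
      have k0' : Continuous (fun y => f θ y) := (s2 θ).continuous
      fun_prop)
    (by
      intro x
      have hp' : deriv (deriv (fun φ' => f θ φ')) (x + 2 * π)
          = deriv (deriv (fun φ' => f θ φ')) x := by
        rw [← deriv_comp_add_const]
        congr 1
        funext y
        rw [← deriv_comp_add_const]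
        simp only [p2]
      simp only [hp', p2])
    (by
      intro n
      rw [q2]
      by_cases h : n ^ 2 = 1
      · have : ((n : ℂ)) ^ 2 = 1 := by exact_mod_cast h
        rw [this]
        simp
      · rw [hn n h, mul_zero]) φ
  exact_mod_cast hz

lemma aux_trig (a b x : ℝ) :
    deriv (deriv (fun t => a * cos t + b * sin t)) x = -(a * cos x + b * sin x) := by
  have h1 : deriv (fun t => a * cos t + b * sin t) = fun t => a * (-sin t) + b * cos t := by
    funext t
    exact (((hasDerivAt_cos t).const_mul a).add ((hasDerivAt_sin t).const_mul b)).deriv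
  rw [h1]
  refine ((((hasDerivAt_sin x).neg).const_mul a).add ((hasDerivAt_cos x).const_mul b)).deriv.trans ?_
  ring

theorem kernel_of_laplacian_plus_two :
    (∀ f : ℝ → ℝ → ℝ, ContDiff ℝ (⊤ : ℕ∞) (fun p : ℝ × ℝ => f p.1 p.2) →
      (∀ θ φ, f (θ + 2 * π) φ = f θ φ) →
      (∀ θ φ, f θ (φ + 2 * π) = f θ φ) →
      (∀ θ φ, deriv (deriv (fun θ' => f θ' φ)) θ
        + deriv (deriv (fun φ' => f θ φ')) φ + 2 * f θ φ = 0) →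
      ∃ A : Matrix (Fin 2) (Fin 2) ℝ, ∀ θ φ, f θ φ = psiFun A θ φ) ∧
    (∀ A : Matrix (Fin 2) (Fin 2) ℝ,
      (∀ θ φ, psiFun A (θ + 2 * π) φ = psiFun A θ φ) ∧
      (∀ θ φ, psiFun A θ (φ + 2 * π) = psiFun A θ φ) ∧
      (∀ θ φ, deriv (deriv (fun θ' => psiFun A θ' φ)) θ
        + deriv (deriv (fun φ' => psiFun A θ φ')) φ + 2 * psiFun A θ φ = 0)) := by
  refine ⟨fun f hf p1 p2 he => ?_, fun A => ⟨fun θ φ => ?_, fun θ φ => ?_, fun θ φ => ?_⟩⟩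
  · have g2 := aux_main hf p1 p2 he
    have s1 : ∀ φ, ContDiff ℝ 2 (fun θ => f θ φ) := fun φ =>
      contDiff_infty.1 (hf.comp (contDiff_id.prodMk contDiff_const)) 2
    have s2 : ∀ θ, ContDiff ℝ 2 (fun φ => f θ φ) := fun θ =>
      contDiff_infty.1 (hf.comp (contDiff_const.prodMk contDiff_id)) 2
    refine ⟨!![f 0 0, f 0 (π / 2); f (π / 2) 0, f (π / 2) (π / 2)], fun θ φ => ?_⟩
    have a := aux_ode (s2 θ) (g2 θ) φ
    have g1 : ∀ φ θ, deriv (deriv (fun θ' => f θ' φ)) θ + f θ φ = 0 := fun φ θ => by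
      linarith [g2 θ φ, he θ φ]
    have b := aux_ode (s1 0) (g1 0) θ
    have c := aux_ode (s1 (π / 2)) (g1 (π / 2)) θ
    simp only [psiFun, Matrix.of_apply, Matrix.cons_val', Matrix.cons_val_zero,
      Matrix.cons_val_one, Matrix.cons_val_fin_one]
    linear_combination a + cos φ * b + sin φ * c
  · simp [psiFun]
  · simp [psiFun]
  · have e1 : (fun θ' => psiFun A θ' φ) = fun t => (A 0 0 * cos φ + A 0 1 * sin φ) * cos t
        + (A 1 0 * cos φ + A 1 1 * sin φ) * sin t := by
      funext t
      simp only [psiFun]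
      ring
    have e2 : (fun φ' => psiFun A θ φ') = fun t => (A 0 0 * cos θ + A 1 0 * sin θ) * cos t
        + (A 0 1 * cos θ + A 1 1 * sin θ) * sin t := by
      funext t
      simp only [psiFun]
      ring
    rw [e1, e2, aux_trig, aux_trig]
    simp only [psiFun]
    ring
end

section
/- Let A be a nonzero non-special 2×2 real matrix, i.e. A ≠ 0 and A Aᵀ is not a scalar multiple of the identity. Then for every 2×2 real matrix B, the set of points (θ,φ) ∈ Z_A at which ψ_B(θ,φ) − ((∂ψ_A/∂θ)(θ,φ))² + ((∂ψ_A/∂φ)(θ,φ))² ≠ 0 is open and dense in Z_A (with the subspace topology from ℝ²). -/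
open Real Matrix

/-- The quantity `ψ_B − (∂ψ_A/∂θ)² + (∂ψ_A/∂φ)²` evaluated at `p = (θ,φ)`. -/
noncomputable def secondDerivQuantity (A B : Matrix (Fin 2) (Fin 2) ℝ) (p : ℝ × ℝ) : ℝ :=
  psiFun B p.1 p.2 - (deriv (fun θ' => psiFun A θ' p.2) p.1) ^ 2
    + (deriv (fun φ' => psiFun A p.1 φ') p.2) ^ 2

open Polynomial in
lemma aux_poly (a b c e B0 B1 B2 B3 : ℝ)
    (h : ∀ t : ℝ, (1 + t ^ 2) * ((a + c * t) ^ 2 + (b + e * t) ^ 2) *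
      ((B1 + B3 * t) * (a + c * t) - (B0 + B2 * t) * (b + e * t)) ^ 2 =
      ((a * e - b * c) ^ 2 * (1 + t ^ 2) ^ 2 - ((a + c * t) ^ 2 + (b + e * t) ^ 2) ^ 2) ^ 2) :
    a * c + b * e = 0 ∧ a ^ 2 + b ^ 2 = c ^ 2 + e ^ 2 := by
  have hP : (1 + X ^ 2) * ((C a + C c * X) ^ 2 + (C b + C e * X) ^ 2) *
      ((C B1 + C B3 * X) * (C a + C c * X) - (C B0 + C B2 * X) * (C b + C e * X)) ^ 2 =
      ((C a * C e - C b * C c) ^ 2 * (1 + X ^ 2) ^ 2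
        - ((C a + C c * X) ^ 2 + (C b + C e * X) ^ 2) ^ 2) ^ 2 := by
    apply Polynomial.funext
    intro t
    simpa using h t
  have h2 := congrArg (aeval Complex.I) hP
  simp at h2
  have h3 : ((a : ℂ) + c * Complex.I) ^ 2 + ((b : ℂ) + e * Complex.I) ^ 2 = 0 := by
    have h4 := h2.symm
    exact pow_eq_zero_iff (two_ne_zero) |>.mp (pow_eq_zero_iff (two_ne_zero) |>.mp h4)
  have hr := congrArg Complex.re h3
  have hi := congrArg Complex.im h3
  simp [pow_two] at hr hi
  constructor <;> linarith

lemma aux_deriv1 (A : Matrix (Fin 2) (Fin 2) ℝ) (θ φ : ℝ) :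
    deriv (fun θ' => psiFun A θ' φ) θ =
      -sin θ * (A 0 0 * cos φ + A 0 1 * sin φ) + cos θ * (A 1 0 * cos φ + A 1 1 * sin φ) := by
  have h : HasDerivAt (fun θ' => cos θ' * (A 0 0 * cos φ + A 0 1 * sin φ)
      + sin θ' * (A 1 0 * cos φ + A 1 1 * sin φ)) _ θ :=
    ((hasDerivAt_cos θ).mul_const _).add ((hasDerivAt_sin θ).mul_const _)
  rw [← h.deriv]
  congr 1
  funext x
  unfold psiFun
  ring

lemma aux_deriv2 (A : Matrix (Fin 2) (Fin 2) ℝ) (θ φ : ℝ) :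
    deriv (fun φ' => psiFun A θ φ') φ =
      -sin φ * (A 0 0 * cos θ + A 1 0 * sin θ) + cos φ * (A 0 1 * cos θ + A 1 1 * sin θ) := by
  have h : HasDerivAt (fun φ' => cos φ' * (A 0 0 * cos θ + A 1 0 * sin θ)
      + sin φ' * (A 0 1 * cos θ + A 1 1 * sin θ)) _ φ :=
    ((hasDerivAt_cos φ).mul_const _).add ((hasDerivAt_sin φ).mul_const _)
  rw [← h.deriv]
  congr 1
  funext x
  unfold psiFun
  ring

lemma aux_nonspecial (A : Matrix (Fin 2) (Fin 2) ℝ)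
    (h : ¬∃ c : ℝ, A * Aᵀ = c • (1 : Matrix (Fin 2) (Fin 2) ℝ)) :
    ¬ (A 0 0 * A 1 0 + A 0 1 * A 1 1 = 0 ∧
      A 0 0 ^ 2 + A 0 1 ^ 2 = A 1 0 ^ 2 + A 1 1 ^ 2) := by
  rintro ⟨h1, h2⟩
  apply h
  refine ⟨A 0 0 ^ 2 + A 0 1 ^ 2, ?_⟩
  ext i j
  fin_cases i <;> fin_cases j <;> simp [Matrix.mul_apply, Fin.sum_univ_two] <;> linarith

/-- Pointwise algebra: where the quantity vanishes on the zero set. -/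
lemma aux_alg (a b c e B0 B1 B2 B3 x y v w : ℝ) (hu : x ^ 2 + y ^ 2 = 1) (hv : v ^ 2 + w ^ 2 = 1)
    (hz : (a * x + c * y) * v + (b * x + e * y) * w = 0)
    (hQ : B0 * x * v + B1 * x * w + B2 * y * v + B3 * y * w
      - (-y * (a * v + b * w) + x * (c * v + e * w)) ^ 2
      + (-w * (a * x + c * y) + v * (b * x + e * y)) ^ 2 = 0) :
    ((a * x + c * y) ^ 2 + (b * x + e * y) ^ 2) *
      ((B1 * x + B3 * y) * (a * x + c * y) - (B0 * x + B2 * y) * (b * x + e * y)) ^ 2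
      - ((a * e - b * c) ^ 2 - ((a * x + c * y) ^ 2 + (b * x + e * y) ^ 2) ^ 2) ^ 2 = 0 := by
  obtain ⟨m, hm⟩ : ∃ m, m = -y * (a * v + b * w) + x * (c * v + e * w) := ⟨_, rfl⟩
  obtain ⟨r, hr⟩ : ∃ r, r = -w * (a * x + c * y) + v * (b * x + e * y) := ⟨_, rfl⟩
  rw [← hm, ← hr] at hQ
  have hw1 : a * x + c * y = -r * w := by
    rw [hr]; linear_combination (-(a * x + c * y)) * hv + v * hz
  have hw2 : b * x + e * y = r * v := by
    rw [hr]; linear_combination (-(b * x + e * y)) * hv + w * hz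
  have hd : a * e - b * c = -(r * m) ∨ a * e - b * c = r * m := by
    have e1 : r * m = -y * (a * (r * v) + b * (r * w)) + x * (c * (r * v) + e * (r * w)) := by
      rw [hm]; ring
    have e2 : r * w = -(a * x + c * y) := by rw [hw1]; ring
    rw [← hw2, e2] at e1
    left
    rw [e1]
    linear_combination (-(a * e - b * c)) * hu
  have hd2 : (a * e - b * c) ^ 2 = r ^ 2 * m ^ 2 := by
    rcases hd with h | h <;> rw [h] <;> ring
  have hN : (a * x + c * y) ^ 2 + (b * x + e * y) ^ 2 = r ^ 2 := by
    rw [hw1, hw2]; linear_combination r ^ 2 * hv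
  have hq : (B1 * x + B3 * y) * (a * x + c * y) - (B0 * x + B2 * y) * (b * x + e * y)
      = -r * (m ^ 2 - r ^ 2) := by
    rw [hw1, hw2]; linear_combination (-r) * hQ
  rw [hN, hq, hd2]; ring

lemma aux_key (A B : Matrix (Fin 2) (Fin 2) ℝ)
    (hA : ¬ (A 0 0 * A 1 0 + A 0 1 * A 1 1 = 0 ∧
      A 0 0 ^ 2 + A 0 1 ^ 2 = A 1 0 ^ 2 + A 1 1 ^ 2))
    (θ φ : ℝ) (hz : psiFun A θ φ = 0)
    (hr : -sin φ * (A 0 0 * cos θ + A 1 0 * sin θ) + cos φ * (A 0 1 * cos θ + A 1 1 * sin θ) ≠ 0)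
    (U : Set (ℝ × ℝ)) (hU : IsOpen U) (hp : (θ, φ) ∈ U) :
    ∃ p ∈ U, psiFun A p.1 p.2 = 0 ∧ secondDerivQuantity A B p ≠ 0 := by
  by_contra! hcon
  apply hA
  set R : ℝ → ℝ := fun t =>
    -sin φ * (A 0 0 * cos t + A 1 0 * sin t) + cos φ * (A 0 1 * cos t + A 1 1 * sin t) with hR
  set S : ℝ → ℝ := fun t => psiFun A t φ with hS
  have hRc : Continuous R := by rw [hR]; fun_prop
  have hSc : Continuous S := by rw [hS]; unfold psiFun; fun_prop
  have hcurve : ContinuousAt (fun t => ((t, φ + arctan (-S t / R t)) : ℝ × ℝ)) θ := by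
    refine continuousAt_id.prodMk (continuousAt_const.add ?_)
    exact continuous_arctan.continuousAt.comp (hSc.neg.continuousAt.div hRc.continuousAt hr)
  have hev1 : ∀ᶠ t in nhds θ, ((t, φ + arctan (-S t / R t)) : ℝ × ℝ) ∈ U := by
    apply hcurve.eventually_mem
    apply hU.mem_nhds
    have : S θ = 0 := hz
    simpa [this] using hp
  have hev2 : ∀ᶠ t in nhds θ, R t ≠ 0 := hRc.continuousAt.eventually_ne hr
  let F : ℝ → ℝ := fun t =>
    ((A 0 0 * cos t + A 1 0 * sin t) ^ 2 + (A 0 1 * cos t + A 1 1 * sin t) ^ 2) *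
      ((B 0 1 * cos t + B 1 1 * sin t) * (A 0 0 * cos t + A 1 0 * sin t)
        - (B 0 0 * cos t + B 1 0 * sin t) * (A 0 1 * cos t + A 1 1 * sin t)) ^ 2
      - ((A 0 0 * A 1 1 - A 0 1 * A 1 0) ^ 2
        - ((A 0 0 * cos t + A 1 0 * sin t) ^ 2 + (A 0 1 * cos t + A 1 1 * sin t) ^ 2) ^ 2) ^ 2
  have hF : ∀ᶠ t in nhds θ, F t = 0 := by
    filter_upwards [hev1, hev2] with t h1 h2
    have hzt : psiFun A t (φ + arctan (-S t / R t)) = 0 := by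
      have e1 : psiFun A t (φ + arctan (-S t / R t)) =
          cos (arctan (-S t / R t)) * S t + sin (arctan (-S t / R t)) * R t := by
        simp only [hS, hR, psiFun, cos_add, sin_add]; ring
      have hc := (cos_arctan_pos (-S t / R t)).ne'
      have e2 : sin (arctan (-S t / R t)) = (-S t / R t) * cos (arctan (-S t / R t)) := by
        rw [← tan_mul_cos hc, tan_arctan]
      rw [e1, e2]; field_simp; ring
    have hQ := hcon _ h1 hzt
    simp only [secondDerivQuantity, aux_deriv1, aux_deriv2] at hQ
    generalize φ + arctan (-S t / R t) = f at hzt hQ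
    refine aux_alg (A 0 0) (A 0 1) (A 1 0) (A 1 1) (B 0 0) (B 0 1) (B 1 0) (B 1 1)
      (cos t) (sin t) (cos f) (sin f) (cos_sq_add_sin_sq t) (cos_sq_add_sin_sq f) ?_ ?_
    · rw [← hzt]; unfold psiFun; ring
    · rw [← hQ]; unfold psiFun; ring
  have hFa : AnalyticOnNhd ℝ F Set.univ := by
    intro t _
    have := analyticAt_cos (x := t)
    have := analyticAt_sin (x := t)
    fun_prop
  have hF0 : ∀ t, F t = 0 := by
    intro t
    have := hFa.eq_of_eventuallyEq (g := fun _ => 0) (fun _ _ => analyticAt_const) hF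
    exact congrFun this t
  apply aux_poly (A 0 0) (A 0 1) (A 1 0) (A 1 1) (B 0 0) (B 0 1) (B 1 0) (B 1 1)
  intro t
  have h := hF0 (arctan t)
  have hc := (cos_arctan_pos t).ne'
  have e2 : sin (arctan t) = t * cos (arctan t) := by
    rw [← tan_mul_cos hc, tan_arctan]
  have e3 : cos (arctan t) ^ 2 * (1 + t ^ 2) = 1 := by
    have := cos_sq_add_sin_sq (arctan t)
    rw [e2] at this; linarith
  simp only [F] at h
  rw [e2] at h
  generalize cos (arctan t) = x at *
  have hx8 : x ^ 8 ≠ 0 := pow_ne_zero _ hc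
  apply mul_left_cancel₀ hx8
  obtain ⟨n, hn⟩ : ∃ n, n = (A 0 0 + A 1 0 * t) ^ 2 + (A 0 1 + A 1 1 * t) ^ 2 := ⟨_, rfl⟩
  obtain ⟨k, hk⟩ : ∃ k, k = (B 0 1 + B 1 1 * t) * (A 0 0 + A 1 0 * t)
    - (B 0 0 + B 1 0 * t) * (A 0 1 + A 1 1 * t) := ⟨_, rfl⟩
  obtain ⟨d, hd⟩ : ∃ d, d = A 0 0 * A 1 1 - A 0 1 * A 1 0 := ⟨_, rfl⟩
  have h' : x ^ 6 * n * k ^ 2 - (d ^ 2 - x ^ 4 * n ^ 2) ^ 2 = 0 := by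
    rw [← h, hn, hk, hd]; ring
  rw [← hn, ← hk, ← hd]
  have l : x ^ 8 * ((1 + t ^ 2) * n * k ^ 2) = (x ^ 2 * (1 + t ^ 2)) * (x ^ 6 * n * k ^ 2) := by
    ring
  have r : x ^ 8 * (d ^ 2 * (1 + t ^ 2) ^ 2 - n ^ 2) ^ 2 =
    (d ^ 2 * (x ^ 2 * (1 + t ^ 2)) ^ 2 - x ^ 4 * n ^ 2) ^ 2 := by ring
  rw [l, r, e3]; linarith

lemma aux_psi_T (A : Matrix (Fin 2) (Fin 2) ℝ) (θ φ : ℝ) : psiFun Aᵀ φ θ = psiFun A θ φ := by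
  simp [psiFun]; ring

lemma aux_nonspecial_T (A : Matrix (Fin 2) (Fin 2) ℝ) (hA : A ≠ 0)
    (h : ¬∃ c : ℝ, A * Aᵀ = c • (1 : Matrix (Fin 2) (Fin 2) ℝ)) :
    ¬∃ c : ℝ, Aᵀ * Aᵀᵀ = c • (1 : Matrix (Fin 2) (Fin 2) ℝ) := by
  rintro ⟨c, hc⟩
  rw [transpose_transpose] at hc
  have hc0 : c ≠ 0 := by
    rintro rfl
    apply hA
    rw [zero_smul] at hc
    have : Aᴴ * A = 0 := by rwa [conjTranspose_eq_transpose_of_trivial]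
    exact conjTranspose_mul_self_eq_zero.mp this
  apply h
  refine ⟨c, ?_⟩
  have h1 : (c⁻¹ • Aᵀ) * A = 1 := by
    rw [smul_mul_assoc, hc, smul_smul, inv_mul_cancel₀ hc0, one_smul]
  have h2 := mul_eq_one_comm.mp h1
  rw [mul_smul_comm] at h2
  rw [← h2, smul_smul, mul_inv_cancel₀ hc0, one_smul]

lemma aux_all (A : Matrix (Fin 2) (Fin 2) ℝ) (hA : A ≠ 0)
    (hns : ¬∃ c : ℝ, A * Aᵀ = c • (1 : Matrix (Fin 2) (Fin 2) ℝ))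
    (B : Matrix (Fin 2) (Fin 2) ℝ)
    (θ φ : ℝ) (hz : psiFun A θ φ = 0)
    (U : Set (ℝ × ℝ)) (hU : IsOpen U) (hp : (θ, φ) ∈ U) :
    ∃ p ∈ U, psiFun A p.1 p.2 = 0 ∧ secondDerivQuantity A B p ≠ 0 := by
  by_cases hr : -sin φ * (A 0 0 * cos θ + A 1 0 * sin θ)
      + cos φ * (A 0 1 * cos θ + A 1 1 * sin θ) = 0
  swap
  · exact aux_key A B (aux_nonspecial A hns) θ φ hz hr U hU hp
  by_cases hm : -sin θ * (A 0 0 * cos φ + A 0 1 * sin φ)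
      + cos θ * (A 1 0 * cos φ + A 1 1 * sin φ) = 0
  swap
  · obtain ⟨p, hpU, hpz, hpQ⟩ := aux_key Aᵀ (-Bᵀ) (aux_nonspecial _ (aux_nonspecial_T A hA hns)) φ θ
      (by rw [aux_psi_T]; exact hz) (by simpa using hm) (Prod.swap ⁻¹' U)
      (hU.preimage continuous_swap) hp
    refine ⟨p.swap, hpU, by rw [← hpz]; exact (aux_psi_T A p.2 p.1).symm, ?_⟩
    intro h0
    apply hpQ
    have : secondDerivQuantity Aᵀ (-Bᵀ) p = - secondDerivQuantity A B p.swap := by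
      simp only [secondDerivQuantity, aux_deriv1, aux_deriv2, Prod.fst_swap, Prod.snd_swap]
      simp only [psiFun, Matrix.neg_apply, Matrix.transpose_apply]
      ring
    rw [this, h0, neg_zero]
  · -- degenerate crossing point
    obtain ⟨k, hk⟩ : ∃ k, k = sin θ * sin φ * A 0 0 - sin θ * cos φ * A 0 1
        - cos θ * sin φ * A 1 0 + cos θ * cos φ * A 1 1 := ⟨_, rfl⟩
    have hu := cos_sq_add_sin_sq θ
    have hv := cos_sq_add_sin_sq φ
    have hz' := hz
    unfold psiFun at hz'
    have hk0 : k ≠ 0 := by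
      intro hk0
      rw [hk0] at hk
      apply hA
      have key : A 0 0 ^ 2 + A 0 1 ^ 2 + A 1 0 ^ 2 + A 1 1 ^ 2 = 0 := by
        have : (A 0 0 ^ 2 + A 0 1 ^ 2 + A 1 0 ^ 2 + A 1 1 ^ 2)
          * ((cos θ ^ 2 + sin θ ^ 2) * (cos φ ^ 2 + sin φ ^ 2)) = 0 ^ 2 + 0 ^ 2 + 0 ^ 2 + 0 ^ 2 := by
          nth_rewrite 1 [← hz']
          nth_rewrite 1 [← hr]
          nth_rewrite 1 [← hm]
          rw [hk]
          ring
        rw [hu, hv] at this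
        linarith
      ext i j
      fin_cases i <;> fin_cases j <;> simp <;> nlinarith [sq_nonneg (A 0 0), sq_nonneg (A 0 1),
        sq_nonneg (A 1 0), sq_nonneg (A 1 1)]
    have hcont : Continuous (fun t : ℝ => ((θ + t, φ) : ℝ × ℝ)) := by fun_prop
    have hmem : ∀ᶠ t in nhds (0 : ℝ), ((θ + t, φ) : ℝ × ℝ) ∈ U := by
      apply hcont.continuousAt.eventually_mem
      apply hU.mem_nhds
      simpa using hp
    obtain ⟨ε, hε, hball⟩ := Metric.eventually_nhds_iff.mp hmem
    have hδ : 0 < min (ε / 2) 1 := by positivity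
    set δ := min (ε / 2) 1 with hδd
    have h1 : δ ≤ ε / 2 := min_le_left _ _
    have h2 : δ ≤ 1 := min_le_right _ _
    have hin : ((θ + δ, φ) : ℝ × ℝ) ∈ U := by
      apply hball
      rw [Real.dist_eq, sub_zero, abs_of_pos hδ]; linarith
    have hs : 0 < sin δ := sin_pos_of_pos_of_le_one hδ h2
    refine aux_key A B (aux_nonspecial A hns) (θ + δ) φ ?_ ?_ U hU hin
    · unfold psiFun
      rw [cos_add, sin_add]
      linear_combination cos δ * hz' + sin δ * hm
    · have : -sin φ * (A 0 0 * cos (θ + δ) + A 1 0 * sin (θ + δ))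
          + cos φ * (A 0 1 * cos (θ + δ) + A 1 1 * sin (θ + δ)) = sin δ * k := by
        rw [cos_add, sin_add, hk]
        linear_combination cos δ * hr
      rw [this]
      exact mul_ne_zero hs.ne' hk0

theorem second_derivative_nonvanishing_nonspecial
    (A : Matrix (Fin 2) (Fin 2) ℝ) (hA : A ≠ 0)
    (hA_nonspecial : ¬∃ c : ℝ, A * Aᵀ = c • (1 : Matrix (Fin 2) (Fin 2) ℝ))
    (B : Matrix (Fin 2) (Fin 2) ℝ) :
    IsOpen {q : {p : ℝ × ℝ // psiFun A p.1 p.2 = 0} | secondDerivQuantity A B q.val ≠ 0} ∧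
    Dense {q : {p : ℝ × ℝ // psiFun A p.1 p.2 = 0} | secondDerivQuantity A B q.val ≠ 0} := by
  constructor
  · have hc : Continuous (fun q : {p : ℝ × ℝ // psiFun A p.1 p.2 = 0} =>
        secondDerivQuantity A B q.val) := by
      simp only [secondDerivQuantity, aux_deriv1, aux_deriv2]
      simp only [psiFun]
      fun_prop
    exact isOpen_ne_fun hc continuous_const
  · rw [dense_iff_inter_open]
    rintro V hV ⟨⟨⟨θ, φ⟩, hz⟩, hq⟩
    obtain ⟨U, hU, rfl⟩ := isOpen_induced_iff.mp hV
    obtain ⟨p, hpU, hpz, hpQ⟩ := aux_all A hA hA_nonspecial B θ φ hz U hU hq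
    exact ⟨⟨p, hpz⟩, hpU, hpQ⟩
end
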